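/- arXiv:2010.02528 — 2 statements merged into one kernel-verified Lean document; each statement's English description precedes it below -/
import Mathlib

section
/- In the projective plane over an algebraically closed field, let L be a general (n+1)-lateral, i.e., the union of n+1 distinct lines whose only singular points are the binom(n+1,2) pairwise intersection points (nodes). Then the linear system of plane curves of degree n passing through all binom(n+1,2) vertices of L has projective dimension exactly n. -/
open Finset

open MvPolynomial in
theorem MvPolynomial.IsHomogeneous.eval_smul_eq_pow_mul {σ R : Type*} [CommSemiring R]
    {F : MvPolynomial σ R} {n : ℕ} (hF : F.IsHomogeneous n) (c : R) (x : σ → R) :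
    eval (c • x) F = c ^ n * eval x F := by
  rw [eval_eq, eval_eq, Finset.mul_sum]
  refine Finset.sum_congr rfl fun d hd => ?_
  have hdeg : ∑ i ∈ d.support, d i = n := by
    simpa [Finsupp.degree_apply] using
      (Finsupp.degree_eq_weight_one (R := ℕ) ▸ hF (mem_support_iff.1 hd) : d.degree = n)
  simp only [Pi.smul_apply, smul_eq_mul, mul_pow, Finset.prod_mul_distrib,
    Finset.prod_pow_eq_pow_sum, hdeg]
  ring

open MvPolynomial in
/-- A polynomial of total degree at most `n` with more than `n` zeros on an affine line vanishes
on that line. -/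
theorem MvPolynomial.eval_add_smul_eq_zero_of_injective {σ R ι : Type*} [CommRing R] [IsDomain R]
    [Fintype ι] {F : MvPolynomial σ R} (hF : F.totalDegree < Fintype.card ι) {p q : σ → R}
    {u : ι → R} (hu : Function.Injective u) (h : ∀ i, eval (p + u i • q) F = 0) (t : R) :
    eval (p + t • q) F = 0 := by
  set g : Polynomial R :=
    aeval (fun m => Polynomial.C (p m) + Polynomial.X * Polynomial.C (q m)) F with hg
  have hgeval (s : R) : g.eval s = eval (p + s • q) F := by
    rw [hg, ← Polynomial.coe_evalRingHom, aeval_def, MvPolynomial.hom_eval₂, ← eval₂_id]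
    congr 1
    · ext; simp
    · ext m
      simpa using mul_comm (q m) s
  have hdeg : g.natDegree < Fintype.card ι := by
    refine lt_of_le_of_lt ?_ hF
    simpa using aeval_natDegree_le (n := 1) F le_rfl _ fun m =>
      (Polynomial.natDegree_add_le _ _).trans (by
        simpa using (Polynomial.natDegree_mul_C_le _ _).trans Polynomial.natDegree_X_le)
  have hg0 : g = 0 := Polynomial.eq_zero_of_natDegree_lt_card_of_eval_eq_zero g hu
    (fun i => by rw [hgeval, h]) hdeg
  rw [← hgeval, hg0, Polynomial.eval_zero]

open MvPolynomial in
/-- A form of degree `n` with `n + 1` zeros `p + u i • q` on the line through `p` and `q` also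
vanishes at `q`. -/
theorem MvPolynomial.IsHomogeneous.eval_eq_zero_of_injective {σ K ι : Type*} [Field K] [Infinite K]
    [Fintype ι] {F : MvPolynomial σ K} {n : ℕ} (hF : F.IsHomogeneous n) (hn : n < Fintype.card ι)
    {p q : σ → K} {u : ι → K} (hu : Function.Injective u)
    (h : ∀ i, eval (p + u i • q) F = 0) : eval q F = 0 := by
  have hline := eval_add_smul_eq_zero_of_injective (hF.totalDegree_le.trans_lt hn) hu h
  have hne (s : K) (hs : s ≠ 0) : eval (q + s • p) F = 0 := by
    have : q + s • p = s • (p + s⁻¹ • q) := by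
      rw [smul_add, smul_inv_smul₀ hs, add_comm]
    rw [this, hF.eval_smul_eq_pow_mul, hline, mul_zero]
  obtain ⟨v⟩ : Nonempty (ι ↪ {s : K // s ≠ 0}) := by
    have : Infinite {s : K // s ≠ 0} := (Set.finite_singleton (0 : K)).infinite_compl.to_subtype
    exact ⟨(Fintype.equivFin ι).toEmbedding.trans
      (Fin.valEmbedding.trans (Infinite.natEmbedding _))⟩
  have := eval_add_smul_eq_zero_of_injective (hF.totalDegree_le.trans_lt hn)
    (Subtype.val_injective.comp v.injective) (fun i => hne _ (v i).2) 0
  simpa using this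

namespace MultiLateral

/-- Any three of the linear forms `ℓ i` on `K³` are linearly independent: the lines they define
are distinct, and no three are concurrent. -/
def IsGeneral {K ι : Type*} [Field K] (ℓ : ι → ((Fin 3 → K) →ₗ[K] K)) : Prop :=
  ∀ i j k, i ≠ j → j ≠ k → i ≠ k → LinearIndependent K ![ℓ i, ℓ j, ℓ k]

section

variable {K ι : Type*} [Field K] {ℓ : ι → ((Fin 3 → K) →ₗ[K] K)}

theorem IsGeneral.eq_zero (hℓ : IsGeneral ℓ) {i j k : ι} (hij : i ≠ j) (hjk : j ≠ k) (hik : i ≠ k)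
    {x : Fin 3 → K} (hi : ℓ i x = 0) (hj : ℓ j x = 0) (hk : ℓ k x = 0) : x = 0 := by
  have hspan := (hℓ i j k hij hjk hik).span_eq_top_of_card_eq_finrank
    (by simp [Subspace.dual_finrank_eq])
  rw [← Module.forall_dual_apply_eq_zero_iff K]
  intro φ
  have hφ : φ ∈ Submodule.span K (Set.range ![ℓ i, ℓ j, ℓ k]) := hspan ▸ Submodule.mem_top
  induction hφ using Submodule.span_induction with
  | mem y hy =>
    obtain ⟨m, rfl⟩ := hy
    fin_cases m <;> simp [hi, hj, hk]
  | zero => simp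
  | add y z _ _ hy hz => simp [hy, hz]
  | smul a y _ hy => simp [hy]

theorem IsGeneral.exists_apply_eq (hℓ : IsGeneral ℓ) {i j k : ι} (hij : i ≠ j) (hjk : j ≠ k)
    (hik : i ≠ k) (a b c : K) : ∃ x, ℓ i x = a ∧ ℓ j x = b ∧ ℓ k x = c := by
  set T : (Fin 3 → K) →ₗ[K] (Fin 3 → K) := LinearMap.pi ![ℓ i, ℓ j, ℓ k] with hT
  have hinj : Function.Injective T := by
    rw [injective_iff_map_eq_zero]
    intro x hx
    exact hℓ.eq_zero hij hjk hik (congrFun hx 0) (congrFun hx 1) (congrFun hx 2)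
  obtain ⟨x, hx⟩ := LinearMap.injective_iff_surjective.1 hinj ![a, b, c]
  exact ⟨x, congrFun hx 0, congrFun hx 1, congrFun hx 2⟩

theorem IsGeneral.exists_apply_eq_pair (hℓ : IsGeneral ℓ) (hcard : 2 < ENat.card ι) {i j : ι}
    (hij : i ≠ j) (a b : K) : ∃ x, ℓ i x = a ∧ ℓ j x = b := by
  obtain ⟨k, hki, hkj⟩ : ∃ k, k ≠ i ∧ k ≠ j := by
    by_contra! H
    have hle : (Set.univ : Set ι).encard ≤ 2 := by
      rw [← Set.encard_pair hij]
      refine Set.encard_le_encard fun k _ => ?_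
      by_cases hk : k = i
      · simp [hk]
      · simp [H k hk]
    rw [Set.encard_univ] at hle
    exact absurd hcard hle.not_gt
  obtain ⟨x, h1, h2, -⟩ := hℓ.exists_apply_eq hij hkj.symm hki.symm a b 0
  exact ⟨x, h1, h2⟩

theorem IsGeneral.exists_mem_line (hℓ : IsGeneral ℓ) [Finite ι] [Infinite K]
    (hcard : 2 < ENat.card ι) (k : ι) : ∃ x, ℓ k x = 0 ∧ ∀ j ≠ k, ℓ j x ≠ 0 := by
  obtain ⟨x, hxk, hx⟩ := Module.Dual.exists_forall_mem_ne_zero_of_forall_exists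
    (LinearMap.ker (ℓ k)) (fun j : {j // j ≠ k} => ℓ j) fun j => by
      obtain ⟨x, h1, h2⟩ := hℓ.exists_apply_eq_pair hcard j.2.symm 0 1
      exact ⟨x, h1, by simp [h2]⟩
  exact ⟨x, hxk, fun j hj => hx ⟨j, hj⟩⟩

open MvPolynomial in
/-- A form of degree `n` vanishing at all vertices of a general `(n + 1)`-lateral and at one
further point of each line is zero. -/
theorem IsGeneral.eq_zero_of_eval_eq_zero (hℓ : IsGeneral ℓ) [Fintype ι] [Infinite K]
    (hcard : 2 < ENat.card ι) {n : ℕ} (hn : n < Fintype.card ι) {F : MvPolynomial (Fin 3) K}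
    (hF : F.IsHomogeneous n)
    (hvert : ∀ i j, i ≠ j → ∀ x, ℓ i x = 0 → ℓ j x = 0 → eval x F = 0)
    {q : ι → Fin 3 → K} (hqk : ∀ k, ℓ k (q k) = 0) (hqj : ∀ k, ∀ j ≠ k, ℓ j (q k) ≠ 0)
    (hq : ∀ k, eval (q k) F = 0) : F = 0 := by
  classical
  have hline (k : ι) (p : Fin 3 → K) (hp : ℓ k p = 0) : eval p F = 0 := by
    by_cases hoff : ∃ j ≠ k, ℓ j p = 0
    · obtain ⟨j, hj, hjp⟩ := hoff
      exact hvert j k hj p hjp hp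
    push Not at hoff
    by_cases hmul : ∃ c : K, p = c • q k
    · obtain ⟨c, rfl⟩ := hmul
      rw [hF.eval_smul_eq_pow_mul, hq, mul_zero]
    refine hF.eval_eq_zero_of_injective hn (p := q k)
      (u := fun j => if j = k then 0 else -(ℓ j (q k) / ℓ j p)) ?_ fun j => ?_
    · intro i j hij
      by_contra hne
      by_cases hi : i = k
      · subst hi
        have hj : j ≠ i := Ne.symm hne
        simp [hj, hqj i j hj, hoff j hj] at hij
      by_cases hj : j = k
      · subst hj
        simp [hi, hqj j i hi, hoff i hi] at hij
      simp only [hi, hj, if_false, neg_inj] at hij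
      have hc : ℓ i (q k) / ℓ i p ≠ 0 := div_ne_zero (hqj k i hi) (hoff i hi)
      have h0 : q k - (ℓ i (q k) / ℓ i p) • p = 0 := by
        refine hℓ.eq_zero hne hj hi ?_ ?_ ?_
        · simp [div_mul_cancel₀ _ (hoff i hi)]
        · rw [hij]
          simp [div_mul_cancel₀ _ (hoff j hj)]
        · simp [hqk, hp]
      exact hmul ⟨_, (eq_inv_smul_iff₀ hc).2 (sub_eq_zero.1 h0).symm⟩
    · by_cases hj : j = k
      · simp [hj, hq]
      · refine hvert j k hj _ ?_ ?_
        · simp [hj, div_mul_cancel₀ _ (hoff j hj)]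
        · simp [hj, hqk, hp]
  refine hF.eq_zero_of_forall_eval_eq_zero fun p => ?_
  by_cases hoff : ∃ k, ℓ k p = 0
  · obtain ⟨k, hk⟩ := hoff
    exact hline k p hk
  push Not at hoff
  obtain ⟨r, hr⟩ := Module.Dual.exists_forall_ne_zero_of_forall_exists
    (fun a : {a : ι × ι // a.1 ≠ a.2} => ℓ a.1.1 p • ℓ a.1.2 - ℓ a.1.2 p • ℓ a.1.1) fun a => by
      obtain ⟨x, h1, h2⟩ := hℓ.exists_apply_eq_pair hcard a.2 0 1
      exact ⟨x, by simp [h1, h2, hoff]⟩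
  refine hF.eval_eq_zero_of_injective hn (p := r) (u := fun j => -(ℓ j r / ℓ j p)) ?_ fun j => ?_
  · intro i j hij
    by_contra hne
    refine hr ⟨(i, j), hne⟩ ?_
    have := hoff i
    have := hoff j
    simp only [neg_inj] at hij
    field_simp at hij
    simp only [LinearMap.sub_apply, LinearMap.smul_apply, smul_eq_mul]
    linear_combination -hij
  · exact hline j _ (by simp [div_mul_cancel₀ _ (hoff j)])

end

open MvPolynomial in
/-- The homogeneous linear polynomial attached to a linear form. -/
noncomputable def toPolynomial {σ K : Type*} [Fintype σ] [DecidableEq σ] [CommSemiring K]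
    (φ : (σ → K) →ₗ[K] K) : MvPolynomial σ K :=
  ∑ m, C (φ (Pi.single m 1)) * X m

open MvPolynomial in
theorem eval_toPolynomial {σ K : Type*} [Fintype σ] [DecidableEq σ] [CommSemiring K]
    (φ : (σ → K) →ₗ[K] K) (x : σ → K) : eval x (toPolynomial φ) = φ x := by
  conv_rhs => rw [pi_eq_sum_univ' x]
  simp [toPolynomial, mul_comm]

theorem isHomogeneous_toPolynomial {σ K : Type*} [Fintype σ] [DecidableEq σ] [CommSemiring K]
    (φ : (σ → K) →ₗ[K] K) : (toPolynomial φ).IsHomogeneous 1 :=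
  MvPolynomial.IsHomogeneous.sum _ _ _ fun _ _ => MvPolynomial.isHomogeneous_C_mul_X _ _

end MultiLateral

open MultiLateral MvPolynomial in
/-- Let `L` be a general `(n+1)`-lateral in the projective plane, given by
`n + 1` linear forms `ℓ i` on `K³`, any three of which are linearly
independent (distinct lines, no three concurrent). The linear system of plane
curves of degree `n` (homogeneous forms of degree `n` in three variables)
passing through all the pairwise intersection points of the lines has
vector-space dimension `n + 1`, i.e. projective dimension exactly `n`. -/
theorem stmt_7 {K : Type*} [Field K] [IsAlgClosed K] (n : ℕ) (hn : 2 ≤ n)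
    (ℓ : Fin (n + 1) → ((Fin 3 → K) →ₗ[K] K))
    (hgen : ∀ i j k : Fin (n + 1), i ≠ j → j ≠ k → i ≠ k →
      LinearIndependent K ![ℓ i, ℓ j, ℓ k]) :
    Module.finrank K
      ↥(MvPolynomial.homogeneousSubmodule (Fin 3) K n ⊓
        ⨅ (i : Fin (n + 1)) (j : Fin (n + 1)) (_ : i ≠ j)
          (x : Fin 3 → K) (_ : ℓ i x = 0) (_ : ℓ j x = 0),
          LinearMap.ker (MvPolynomial.aeval x).toLinearMap) = n + 1 := by
  have : Infinite K := IsAlgClosed.instInfinite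
  have hℓ : IsGeneral ℓ := hgen
  have hcard : 2 < ENat.card (Fin (n + 1)) := by
    rw [ENat.card_eq_coe_fintype_card, Fintype.card_fin]
    exact_mod_cast Nat.lt_succ_of_le hn
  set V := homogeneousSubmodule (Fin 3) K n ⊓
        ⨅ (i : Fin (n + 1)) (j : Fin (n + 1)) (_ : i ≠ j)
          (x : Fin 3 → K) (_ : ℓ i x = 0) (_ : ℓ j x = 0),
          LinearMap.ker (MvPolynomial.aeval x).toLinearMap with hV
  have hmem (F : MvPolynomial (Fin 3) K) : F ∈ V ↔ F.IsHomogeneous n ∧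
      ∀ i j, i ≠ j → ∀ x, ℓ i x = 0 → ℓ j x = 0 → eval x F = 0 := by
    simp [hV, Submodule.mem_iInf, aeval_eq_eval]
  choose q hqk hqj using hℓ.exists_mem_line hcard
  let Φ : V →ₗ[K] (Fin (n + 1) → K) :=
    LinearMap.pi fun k => (aeval (q k)).toLinearMap ∘ₗ V.subtype
  have hΦ (F : V) (k) : Φ F k = eval (q k) F.1 := by
    simp [Φ, aeval_eq_eval]
  have hinj : Function.Injective Φ := by
    rw [injective_iff_map_eq_zero]
    intro F hFq
    obtain ⟨hF, hvert⟩ := (hmem F).1 F.2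
    exact Subtype.ext (hℓ.eq_zero_of_eval_eq_zero hcard (by simp) hF hvert hqk hqj fun k => by
      rw [← hΦ, hFq, Pi.zero_apply])
  let P (k : Fin (n + 1)) : MvPolynomial (Fin 3) K := ∏ i ∈ univ.erase k, toPolynomial (ℓ i)
  have hPeval (k x) : eval x (P k) = ∏ i ∈ univ.erase k, ℓ i x := by
    simp [P, map_prod, eval_toPolynomial]
  have hP (k) : P k ∈ V := by
    refine (hmem _).2 ⟨?_, fun i j hij x hi hj => ?_⟩
    · simpa using IsHomogeneous.prod (univ.erase k) (fun i => toPolynomial (ℓ i)) (fun _ => 1)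
        fun i _ => isHomogeneous_toPolynomial (ℓ i)
    · rw [hPeval]
      by_cases hik : i = k
      · exact prod_eq_zero (mem_erase.2 ⟨fun h => hij (hik.trans h.symm), mem_univ j⟩) hj
      · exact prod_eq_zero (mem_erase.2 ⟨hik, mem_univ i⟩) hi
  have hsurj : Function.Surjective Φ := by
    intro c
    refine ⟨∑ k, (c k / eval (q k) (P k)) • ⟨P k, hP k⟩, ?_⟩
    ext m
    rw [map_sum, Finset.sum_apply, sum_eq_single m]
    · rw [map_smul, Pi.smul_apply, hΦ, smul_eq_mul, div_mul_cancel₀]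
      rw [hPeval]
      exact prod_ne_zero_iff.2 fun i hi => hqj m i (ne_of_mem_erase hi)
    · intro k _ hk
      have h0 : ∏ i ∈ univ.erase k, ℓ i (q m) = 0 :=
        prod_eq_zero (mem_erase.2 ⟨hk.symm, mem_univ m⟩) (hqk m)
      rw [map_smul, Pi.smul_apply, hΦ, hPeval k (q m), h0, smul_zero]
    · simp
  rw [(LinearEquiv.ofBijective Φ ⟨hinj, hsurj⟩).finrank_eq, Module.finrank_fintype_fun_eq_card,
    Fintype.card_fin]
end

section
/- Let K be an algebraically closed field, a_0, ..., a_n ∈ K distinct, A_i, B_i ∈ K nonzero. Suppose k ∈ K is such that the equation ∑_{i=0}^n A_iB_i/(x − a_i) = 1/k has n+1 distinct roots k_0, ..., k_n in K ∖ {a_0, ..., a_n}. Then for all pairs ℓ ≠ m in {0, ..., n}, ∑_{i=0}^n A_iB_i/((k_ℓ − a_i)(k_m − a_i)) = 0; that is, the n+1 parameters k_0, ..., k_n simultaneously satisfy all binom(n+1,2) incidence conditions between the corresponding points of C_1 and hyperosculating hyperplanes of C_2. -/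
/-- If the equation `∑ i, A i * B i / (x - a i) = 1/k` has `n + 1` distinct
roots `k 0, …, k n`, all avoiding `a 0, …, a n`, then for all `ℓ ≠ m` the
incidence condition `∑ i, A i * B i / ((k ℓ - a i) * (k m - a i)) = 0` holds:
the `n+1` parameters simultaneously satisfy all `(n+1 choose 2)` incidence
conditions between points of `C₁` and hyperosculating hyperplanes of `C₂`. -/
theorem stmt_10 {K : Type*} [Field K] [IsAlgClosed K] (n : ℕ)
    (a A B : Fin (n + 1) → K) (ha : Function.Injective a)
    (hA : ∀ i, A i ≠ 0) (hB : ∀ i, B i ≠ 0) (k : K)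
    (r : Fin (n + 1) → K) (hr : Function.Injective r)
    (hra : ∀ i j, r i ≠ a j)
    (hroot : ∀ i, ∑ j, A j * B j / (r i - a j) = 1 / k) :
    ∀ ℓ m : Fin (n + 1), ℓ ≠ m →
      ∑ i, A i * B i / ((r ℓ - a i) * (r m - a i)) = 0 := by
  intro ℓ m hℓm
  have hsub : r m - r ℓ ≠ 0 := sub_ne_zero.mpr (hr.ne hℓm.symm)
  refine (mul_eq_zero.mp ?_).resolve_left hsub
  calc (r m - r ℓ) * ∑ i, A i * B i / ((r ℓ - a i) * (r m - a i))
      = ∑ i, (A i * B i / (r ℓ - a i) - A i * B i / (r m - a i)) := by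
        rw [Finset.mul_sum]
        refine Finset.sum_congr rfl fun i _ => ?_
        have hℓ : r ℓ - a i ≠ 0 := sub_ne_zero.mpr (hra ℓ i)
        have hm : r m - a i ≠ 0 := sub_ne_zero.mpr (hra m i)
        field_simp
        ring
    _ = 0 := by rw [Finset.sum_sub_distrib, hroot, hroot, sub_self]
end
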